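/- Let G be a weighted graph with n vertices, M a matching in G, and suppose G contains no M-augmenting cycle, no M-augmenting bi-cycle, and no M-augmenting flower whose root is M-covered. Let u be an M-exposed vertex and v an M-covered vertex, and assume there is no M-augmenting flower rooted at u. Then there exists an M-augmenting path from u to v if and only if there exists an M-augmenting walk from u to v of length at most 3n. -/

import Mathlib

namespace Stabilizer

variable {V : Type*} [Fintype V] [DecidableEq V]

/-- The set of vertices covered by a finite set of edges. -/
def edgeVerts (C : Finset (Sym2 V)) : Set V := {v | ∃ e ∈ C, v ∈ e}

/-- A matching of `G`, given as a finite set of pairwise vertex-disjoint edges. -/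
def IsMatching (G : SimpleGraph V) (M : Finset (Sym2 V)) : Prop :=
  (↑M ⊆ G.edgeSet) ∧ ∀ e ∈ M, ∀ f ∈ M, e ≠ f → ∀ v : V, v ∈ e → v ∉ f

/-- The total weight of a finite set of edges. -/
noncomputable def setWeight (w : Sym2 V → ℝ) (M : Finset (Sym2 V)) : ℝ := ∑ e ∈ M, w e

/-- ν(G): the maximum weight of a matching of `G`. -/
noncomputable def nu (G : SimpleGraph V) (w : Sym2 V → ℝ) : ℝ :=
  sSup {r : ℝ | ∃ M : Finset (Sym2 V), IsMatching G M ∧ r = setWeight w M}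

/-- A fractional matching of `G`. -/
def IsFracMatching (G : SimpleGraph V) (x : Sym2 V → ℝ) : Prop :=
  (∀ e, 0 ≤ x e) ∧ (∀ e, e ∉ G.edgeSet → x e = 0) ∧ ∀ v : V, ∑ u : V, x s(v, u) ≤ 1

/-- The weight of a fractional matching. -/
noncomputable def fracWeight (w x : Sym2 V → ℝ) : ℝ := ∑ e : Sym2 V, w e * x e

/-- ν_f(G): the maximum weight of a fractional matching of `G`. -/
noncomputable def nuf (G : SimpleGraph V) (w : Sym2 V → ℝ) : ℝ :=
  sSup {r : ℝ | ∃ x : Sym2 V → ℝ, IsFracMatching G x ∧ r = fracWeight w x}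

/-- A maximum-weight fractional matching of `G`. -/
def IsMaxFracMatching (G : SimpleGraph V) (w x : Sym2 V → ℝ) : Prop :=
  IsFracMatching G x ∧ ∀ y : Sym2 V → ℝ, IsFracMatching G y → fracWeight w y ≤ fracWeight w x

/-- All entries lie in {0, 1/2, 1}. -/
def IsHalfIntegral (x : Sym2 V → ℝ) : Prop := ∀ e, x e = 0 ∨ x e = 1 / 2 ∨ x e = 1

/-- `C` is the edge set of an odd cycle of `G`. -/
def IsOddCycleEdgeSet (G : SimpleGraph V) (C : Finset (Sym2 V)) : Prop :=
  ∃ (v : V) (c : G.Walk v v), c.IsCycle ∧ Odd c.length ∧ c.edges.toFinset = C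

/-- `F` is the family 𝒞(x) of vertex-disjoint odd cycles carrying exactly the
half-valued edges of `x`. -/
def IsCycleFamily (G : SimpleGraph V) (x : Sym2 V → ℝ) (F : Finset (Finset (Sym2 V))) : Prop :=
  (∀ C ∈ F, IsOddCycleEdgeSet G C) ∧
  (∀ C ∈ F, ∀ D ∈ F, C ≠ D → Disjoint (edgeVerts C) (edgeVerts D)) ∧
  (∀ e : Sym2 V, x e = 1 / 2 ↔ ∃ C ∈ F, e ∈ C)

/-- A basic fractional matching of `G`. -/
def IsBasic (G : SimpleGraph V) (x : Sym2 V → ℝ) : Prop :=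
  IsFracMatching G x ∧ IsHalfIntegral x ∧ ∃ F, IsCycleFamily G x F

/-- γ(G): the minimum number of odd cycles in the support of a basic
maximum-weight fractional matching of `G`. -/
noncomputable def gamma (G : SimpleGraph V) (w : Sym2 V → ℝ) : ℕ :=
  sInf {n : ℕ | ∃ (x : Sym2 V → ℝ) (F : Finset (Finset (Sym2 V))),
    IsMaxFracMatching G w x ∧ IsHalfIntegral x ∧ IsCycleFamily G x F ∧ F.card = n}

/-- `G` is stable: ν(G) = ν_f(G). -/
def IsStable (G : SimpleGraph V) (w : Sym2 V → ℝ) : Prop := nu G w = nuf G w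

/-- Deletion of a set of vertices (as the spanning subgraph obtained by
removing all edges incident to `S`; matchings, fractional matchings and covers
of `G∖S` correspond to those of this graph). -/
def deleteVerts (G : SimpleGraph V) (S : Set V) : SimpleGraph V where
  Adj a b := G.Adj a b ∧ a ∉ S ∧ b ∉ S
  symm := ⟨fun _ _ h => ⟨h.1.symm, h.2.2, h.2.1⟩⟩
  loopless := ⟨fun a h => G.loopless.irrefl a h.1⟩

/-- A fractional w-vertex cover of `G`. -/
def IsFracCover (G : SimpleGraph V) (w : Sym2 V → ℝ) (y : V → ℝ) : Prop :=
  (∀ v, 0 ≤ y v) ∧ ∀ a b : V, G.Adj a b → w s(a, b) ≤ y a + y b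

noncomputable def coverValue (y : V → ℝ) : ℝ := ∑ v : V, y v

/-- A minimum fractional w-vertex cover of `G`. -/
def IsMinFracCover (G : SimpleGraph V) (w : Sym2 V → ℝ) (y : V → ℝ) : Prop :=
  IsFracCover G w y ∧ ∀ z : V → ℝ, IsFracCover G w z → coverValue y ≤ coverValue z

/-- M(x): the 1-valued edges of `x`. -/
noncomputable def oneEdges (x : Sym2 V → ℝ) : Finset (Sym2 V) :=
  Finset.univ.filter fun e => x e = 1

/-- `v` is exposed by the matching `M`. -/
def MExposed (M : Finset (Sym2 V)) (v : V) : Prop := ∀ e ∈ M, v ∉ e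

/-- A list of edges alternately in and out of `M`. -/
def AltList (M : Finset (Sym2 V)) (l : List (Sym2 V)) : Prop :=
  l.Chain' fun e f => (e ∈ M ↔ f ∉ M)

variable {G : SimpleGraph V}

/-- An M-alternating walk. -/
def IsAltWalk (M : Finset (Sym2 V)) {a b : V} (p : G.Walk a b) : Prop := AltList M p.edges

/-- A valid walk: it starts (resp. ends) with an M-exposed vertex or an edge of `M`. -/
def IsValidWalk (M : Finset (Sym2 V)) {a b : V} (p : G.Walk a b) : Prop :=
  (MExposed M a ∨ ∃ e ∈ M, p.edges.head? = some e) ∧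
  (MExposed M b ∨ ∃ e ∈ M, p.edges.getLast? = some e)

/-- w(P ∩ M), with multiplicity. -/
noncomputable def wIn (w : Sym2 V → ℝ) (M : Finset (Sym2 V)) (l : List (Sym2 V)) : ℝ :=
  (l.map fun e => if e ∈ M then w e else 0).sum

/-- w(P ∖ M), with multiplicity. -/
noncomputable def wOut (w : Sym2 V → ℝ) (M : Finset (Sym2 V)) (l : List (Sym2 V)) : ℝ :=
  (l.map fun e => if e ∈ M then 0 else w e).sum

/-- An M-augmenting walk. -/
def IsAugWalk (w : Sym2 V → ℝ) (M : Finset (Sym2 V)) {a b : V} (p : G.Walk a b) : Prop :=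
  IsAltWalk M p ∧ IsValidWalk M p ∧ wIn w M p.edges < wOut w M p.edges

/-- An M-augmenting path. -/
def IsAugPath (w : Sym2 V → ℝ) (M : Finset (Sym2 V)) {a b : V} (p : G.Walk a b) : Prop :=
  p.IsPath ∧ IsAugWalk w M p

/-- An M-alternating cycle (an even cycle alternately in and out of `M`). -/
def IsAltCycle (M : Finset (Sym2 V)) {a : V} (c : G.Walk a a) : Prop :=
  c.IsCycle ∧ Even c.length ∧ AltList M c.edges ∧
  ∀ e f : Sym2 V, c.edges.head? = some e → c.edges.getLast? = some f → (e ∈ M ↔ f ∉ M)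

/-- An M-augmenting cycle. -/
def IsAugCycle (w : Sym2 V → ℝ) (M : Finset (Sym2 V)) {a : V} (c : G.Walk a a) : Prop :=
  IsAltCycle M c ∧ wIn w M c.edges < wOut w M c.edges

/-- An M-blossom with base `a` (traversed starting and ending at its base). -/
def IsBlossom (M : Finset (Sym2 V)) {a : V} (c : G.Walk a a) : Prop :=
  c.IsCycle ∧ Odd c.length ∧ AltList M c.edges ∧
  ∀ e : Sym2 V, c.edges.head? = some e → e ∉ M

/-- An M-flower: an M-blossom `c` with base `a` together with a valid M-alternating
path `p` from the base `a` to the root `r`, starting with an edge of `M`. -/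
def IsFlower (M : Finset (Sym2 V)) {a r : V} (c : G.Walk a a) (p : G.Walk a r) : Prop :=
  IsBlossom M c ∧ p.IsPath ∧ AltList M p.edges ∧
  (∃ e ∈ M, p.edges.head? = some e) ∧
  (MExposed M r ∨ ∃ e ∈ M, p.edges.getLast? = some e)

/-- An M-augmenting flower (with root `r`). -/
def IsAugFlower (w : Sym2 V → ℝ) (M : Finset (Sym2 V)) {a r : V}
    (c : G.Walk a a) (p : G.Walk a r) : Prop :=
  IsFlower M c p ∧
  wIn w M c.edges + 2 * wIn w M p.edges < wOut w M c.edges + 2 * wOut w M p.edges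

/-- An M-bi-cycle: two M-blossoms `c`, `d` with bases `a`, `b` joined by an odd
M-alternating path `p` starting and ending with edges of `M`. -/
def IsBicycle (M : Finset (Sym2 V)) {a b : V}
    (c : G.Walk a a) (p : G.Walk a b) (d : G.Walk b b) : Prop :=
  IsBlossom M c ∧ IsBlossom M d ∧ p.IsPath ∧ Odd p.length ∧ AltList M p.edges ∧
  (∃ e ∈ M, p.edges.head? = some e) ∧ (∃ e ∈ M, p.edges.getLast? = some e)

/-- An M-augmenting bi-cycle. -/
def IsAugBicycle (w : Sym2 V → ℝ) (M : Finset (Sym2 V)) {a b : V}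
    (c : G.Walk a a) (p : G.Walk a b) (d : G.Walk b b) : Prop :=
  IsBicycle M c p d ∧
  wIn w M c.edges + 2 * wIn w M p.edges + wIn w M d.edges <
    wOut w M c.edges + 2 * wOut w M p.edges + wOut w M d.edges

/-- All edges of the walk are tight with respect to the fractional vertex cover `y`. -/
def IsTightWalk (w : Sym2 V → ℝ) (y : V → ℝ) {a b : V} (p : G.Walk a b) : Prop :=
  ∀ d ∈ p.darts, y d.toProd.1 + y d.toProd.2 = w s(d.toProd.1, d.toProd.2)

/-- `x'` is the result of alternate rounding on the odd cycle with edge set `C`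
at the vertex `u`: on `C` it is 0/1-valued, both edges of `C` at `u` get value 0,
and its 1-valued edges inside `C` perfectly match the remaining vertices of `C`. -/
def AltRoundedOn (x' : Sym2 V → ℝ) (C : Finset (Sym2 V)) (u : V) : Prop :=
  (∀ e ∈ C, x' e = 0 ∨ x' e = 1) ∧ (∀ e ∈ C, u ∈ e → x' e = 0) ∧
  ∀ z ∈ edgeVerts C, z ≠ u → ∃! e : Sym2 V, e ∈ C ∧ x' e = 1 ∧ z ∈ e


set_option linter.unusedSectionVars false

/-- The gain `w(P ∖ M) - w(P ∩ M)` of a list of edges. -/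
noncomputable def gain (w : Sym2 V → ℝ) (M : Finset (Sym2 V)) (l : List (Sym2 V)) : ℝ :=
  wOut w M l - wIn w M l

lemma gain_append (w : Sym2 V → ℝ) (M : Finset (Sym2 V)) (l m : List (Sym2 V)) :
    gain w M (l ++ m) = gain w M l + gain w M m := by
  simp [gain, wIn, wOut]; ring

lemma gain_cons_of_notMem (w : Sym2 V → ℝ) {M : Finset (Sym2 V)} {e : Sym2 V} (he : e ∉ M)
    (l : List (Sym2 V)) : gain w M (e :: l) = w e + gain w M l := by
  simp [gain, wIn, wOut, he]; ring

lemma gain_reverse (w : Sym2 V → ℝ) (M : Finset (Sym2 V)) (l : List (Sym2 V)) :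
    gain w M l.reverse = gain w M l := by
  simp [gain, wIn, wOut, List.map_reverse, List.sum_reverse]

lemma altList_reverse {M : Finset (Sym2 V)} {l : List (Sym2 V)} (h : AltList M l) :
    AltList M l.reverse := by
  change List.IsChain _ _ at h
  change List.IsChain _ _
  rw [List.isChain_reverse]
  exact h.imp fun e f hef => by tauto

lemma altList_append {M : Finset (Sym2 V)} {l m : List (Sym2 V)} :
    AltList M (l ++ m) ↔ AltList M l ∧ AltList M m ∧
      ∀ e, l.getLast? = some e → ∀ f, m.head? = some f → (e ∈ M ↔ f ∉ M) :=
  List.isChain_append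

/-- The ends of a nonempty alternating list are of the same kind iff its length is odd. -/
lemma AltList.odd_length_iff {M : Finset (Sym2 V)} {l : List (Sym2 V)} (h : AltList M l)
    {e f : Sym2 V} (he : l.head? = some e) (hf : l.getLast? = some f) :
    Odd l.length ↔ (e ∈ M ↔ f ∈ M) := by
  induction l generalizing e with
  | nil => simp at he
  | cons a l ih =>
    cases l with
    | nil => simp_all
    | cons b l =>
      have hab : a ∈ M ↔ b ∉ M := (List.isChain_cons_cons.1 h).1
      have h2 := ih (List.isChain_cons_cons.1 h).2 rfl (by simpa using hf)
      have hae : a = e := by simpa using he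
      subst hae
      rw [List.length_cons, Nat.odd_add_one, h2]
      tauto

/-- A walk whose edge list is alternating, starting and ending with an edge of `M`. -/
def IsMatchedWalk (M : Finset (Sym2 V)) {a b : V} (p : G.Walk a b) : Prop :=
  AltList M p.edges ∧ (∃ e ∈ M, p.edges.head? = some e) ∧ ∃ e ∈ M, p.edges.getLast? = some e

lemma IsMatchedWalk.reverse {M : Finset (Sym2 V)} {a b : V} {p : G.Walk a b}
    (h : IsMatchedWalk M p) : IsMatchedWalk M p.reverse := by
  obtain ⟨h1, h2, h3⟩ := h
  refine ⟨?_, ?_, ?_⟩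
  · rw [SimpleGraph.Walk.edges_reverse]; exact altList_reverse h1
  · simpa using h3
  · simpa using h2

lemma IsMatchedWalk.odd_length {M : Finset (Sym2 V)} {a b : V} {p : G.Walk a b}
    (h : IsMatchedWalk M p) : Odd p.length := by
  obtain ⟨h1, ⟨e, he, he'⟩, ⟨f, hf, hf'⟩⟩ := h
  rw [← SimpleGraph.Walk.length_edges, h1.odd_length_iff he' hf']
  tauto

lemma IsMatchedWalk.not_isPath {M : Finset (Sym2 V)} {a : V} {p : G.Walk a a}
    (h : IsMatchedWalk M p) : ¬ p.IsPath := by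
  intro hp
  have := h.odd_length
  simp [(SimpleGraph.Walk.isPath_iff_nil.1 hp).eq_nil] at this

lemma not_mExposed_of_altList {M : Finset (Sym2 V)} {a b : V} (p : G.Walk a b)
    (h : AltList M p.edges) (hl : ∃ e ∈ M, p.edges.getLast? = some e) (ha : ¬ MExposed M a)
    {z : V} (hz : z ∈ p.support) : ¬ MExposed M z := by
  induction p with
  | nil => simp at hl
  | @cons a c b hac p ih =>
    rw [SimpleGraph.Walk.support_cons, List.mem_cons] at hz
    rcases hz with rfl | hz
    · exact ha
    cases p with
    | nil =>
      obtain ⟨e, he, hee⟩ := hl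
      have hec : s(a, c) = e := by simpa using hee
      have hzc : z = c := by simpa using hz
      subst hzc hec
      exact fun hx => hx _ he (by simp)
    | @cons _ d _ hcd q =>
      have h' := List.isChain_cons_cons.1 h
      refine ih h'.2 (by simpa using hl) ?_ hz
      intro hx
      by_cases hm : s(a, c) ∈ M
      · exact hx _ hm (by simp)
      · have : s(c, d) ∈ M := by tauto
        exact hx _ this (by simp)

lemma IsMatchedWalk.not_mExposed {M : Finset (Sym2 V)} {a b : V} {p : G.Walk a b}
    (h : IsMatchedWalk M p) {z : V} (hz : z ∈ p.support) : ¬ MExposed M z := by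
  refine not_mExposed_of_altList p h.1 h.2.2 ?_ hz
  obtain ⟨e, he, hee⟩ := h.2.1
  cases p with
  | nil => simp at hee
  | cons hac p =>
    intro hx
    have := by simpa using hee
    exact hx e he (by simp [← this])

/-- A walk that is not a path contains a closed subwalk without inner repetitions. -/
lemma exists_append_cons_append_of_not_isPath {a b : V} (p : G.Walk a b) (hp : ¬ p.IsPath) :
    ∃ (x y : V) (A : G.Walk a x) (h : G.Adj x y) (q : G.Walk y x) (B : G.Walk x b),
      q.IsPath ∧ p = A.append ((SimpleGraph.Walk.cons h q).append B) := by
  induction p with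
  | nil => simp at hp
  | @cons a c b hac p ih =>
    by_cases hpp : p.IsPath
    · have ha : a ∈ p.support := by
        by_contra ha
        exact hp (hpp.cons ha)
      refine ⟨a, c, .nil, hac, p.takeUntil a ha, p.dropUntil a ha, hpp.takeUntil ha, ?_⟩
      simp
    · obtain ⟨x, y, A, h, q, B, hq, rfl⟩ := ih hpp
      exact ⟨x, y, .cons hac A, h, q, B, hq, by simp⟩

lemma isCycle_cons_of_altList {M : Finset (Sym2 V)} {x y : V} (h : G.Adj x y) (q : G.Walk y x)
    (hq : q.IsPath) (ha : AltList M (SimpleGraph.Walk.cons h q).edges) :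
    (SimpleGraph.Walk.cons h q).IsCycle := by
  rw [SimpleGraph.Walk.cons_isCycle_iff]
  refine ⟨hq, fun hmem => ?_⟩
  cases q with
  | nil => simp at hmem
  | @cons _ z _ hyz q =>
    have hy : y ∉ q.support := (SimpleGraph.Walk.cons_isPath_iff _ _).1 hq |>.2
    rw [SimpleGraph.Walk.edges_cons, List.mem_cons] at hmem
    rcases hmem with he | he
    · have h' : s(x, y) ∈ M ↔ s(y, z) ∉ M := (List.isChain_cons_cons.1 ha).1
      rw [← he] at h'
      tauto
    · exact hy (q.snd_mem_support_of_mem_edges he)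

lemma IsMatching.last_notMem_of_isCycle {M : Finset (Sym2 V)} (hM : IsMatching G M) {x y : V}
    {h : G.Adj x y} {q : G.Walk y x} (hc : (SimpleGraph.Walk.cons h q).IsCycle)
    {f : Sym2 V} (hf : (SimpleGraph.Walk.cons h q).edges.getLast? = some f)
    (he : s(x, y) ∈ M) : f ∉ M := by
  intro hfM
  have hq := (SimpleGraph.Walk.cons_isCycle_iff _ _).1 hc
  have hxf : x ∈ f := by
    have h0 := SimpleGraph.Walk.edges_reverse (SimpleGraph.Walk.cons h q)
    rw [← List.head?_reverse, ← h0] at hf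
    revert hf
    cases (SimpleGraph.Walk.cons h q).reverse with
    | nil => simp
    | cons h' r =>
      intro hf
      have := by simpa using hf
      simp [← this]
  have hfq : f ∈ q.edges := by
    cases q with
    | nil => exact absurd h (G.loopless.irrefl _)
    | cons h' r =>
      rw [SimpleGraph.Walk.edges_cons, SimpleGraph.Walk.edges_cons, List.getLast?_cons_cons] at hf
      exact List.mem_of_getLast? hf
  refine hM.2 _ he _ hfM ?_ x (by simp) hxf
  rintro rfl
  exact hq.2 hfq

/-- Splicing out of `A ++ C ++ B` a list `C` whose ends are of different kinds. -/
lemma altList_splice {M : Finset (Sym2 V)} {A C B : List (Sym2 V)} {e f : Sym2 V}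
    (he : C.head? = some e) (hf : C.getLast? = some f) (hef : e ∈ M ↔ f ∉ M)
    (h : AltList M (A ++ (C ++ B))) (hh : ∃ e ∈ M, (A ++ (C ++ B)).head? = some e)
    (hl : ∃ e ∈ M, (A ++ (C ++ B)).getLast? = some e) :
    AltList M (A ++ B) ∧ (∃ e ∈ M, (A ++ B).head? = some e) ∧
      ∃ e ∈ M, (A ++ B).getLast? = some e := by
  rw [altList_append, altList_append] at h
  obtain ⟨hA, ⟨hC, hB, hCB⟩, hAC⟩ := h
  simp only [List.head?_append, List.getLast?_append, he, hf, Option.some_or] at *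
  refine ⟨altList_append.2 ⟨hA, hB, fun g hg k hk => ?_⟩, ?_, ?_⟩
  · have := hAC g hg e rfl
    have := hCB f rfl k hk
    tauto
  · cases hA' : A.head? with
    | some g => simpa [hA'] using hh
    | none =>
      cases hB' : B.head? with
      | some k =>
        have := hCB f rfl k hB'
        simp [hA'] at hh ⊢
        tauto
      | none =>
        simp at hA' hB'
        subst hA' hB'
        simp at hh hl
        tauto
  · cases hB' : B.getLast? with
    | some g => simpa [hB'] using hl
    | none =>
      cases hA' : A.getLast? with
      | some k =>
        have := hAC k hA' e rfl
        simp [hB'] at hl ⊢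
        tauto
      | none =>
        simp at hA' hB'
        subst hA' hB'
        simp at hh hl
        tauto

/-- Splitting `A ++ C ++ B` at a list `C` whose ends are both outside `M`. -/
lemma altList_split {M : Finset (Sym2 V)} {A C B : List (Sym2 V)} {e f : Sym2 V}
    (he : C.head? = some e) (hf : C.getLast? = some f) (heM : e ∉ M) (hfM : f ∉ M)
    (h : AltList M (A ++ (C ++ B))) (hh : ∃ e ∈ M, (A ++ (C ++ B)).head? = some e)
    (hl : ∃ e ∈ M, (A ++ (C ++ B)).getLast? = some e) :
    (AltList M A ∧ (∃ e ∈ M, A.head? = some e) ∧ ∃ e ∈ M, A.getLast? = some e) ∧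
      (AltList M B ∧ (∃ e ∈ M, B.head? = some e) ∧ ∃ e ∈ M, B.getLast? = some e) := by
  rw [altList_append, altList_append] at h
  obtain ⟨hA, ⟨hC, hB, hCB⟩, hAC⟩ := h
  simp only [List.head?_append, List.getLast?_append, he, hf, Option.some_or] at *
  have hAne : A ≠ [] := by
    rintro rfl
    simp at hh
    tauto
  have hBne : B ≠ [] := by
    rintro rfl
    simp at hl
    tauto
  have h1 := List.head?_eq_some_head hAne
  have h2 := List.getLast?_eq_some_getLast hAne
  have h3 := List.head?_eq_some_head hBne
  have h4 := List.getLast?_eq_some_getLast hBne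
  have h5 := hAC _ h2 e rfl
  have h6 := hCB f rfl _ h3
  refine ⟨⟨hA, ?_, ⟨_, by tauto, h2⟩⟩, ⟨hB, ⟨_, by tauto, h3⟩, ?_⟩⟩
  · simpa [h1] using hh
  · simpa [h4] using hl

/-- If `T a t` records admissible terminals `a` of value `t`, containing every blossom with half of
its gain, and the bound `t + gain + s ≤ 0` holds for paths between terminals, then it holds for
walks between terminals. -/
lemma gain_le_zero_of_isMatchedWalk {w : Sym2 V → ℝ} {M : Finset (Sym2 V)} (hM : IsMatching G M)
    (hnoCycle : ∀ (a : V) (c : G.Walk a a), ¬ IsAugCycle w M c) (T : V → ℝ → Prop)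
    (hblossom : ∀ (a : V) (c : G.Walk a a), IsBlossom M c → T a (gain w M c.edges / 2))
    (hpath : ∀ (a b : V) (t s : ℝ) (p : G.Walk a b), T a t → T b s → p.IsPath →
      IsMatchedWalk M p → t + gain w M p.edges + s ≤ 0)
    {a b : V} {t s : ℝ} (p : G.Walk a b) (ha : T a t) (hb : T b s) (hp : IsMatchedWalk M p) :
    t + gain w M p.edges + s ≤ 0 := by
  induction hn : p.length using Nat.strong_induction_on generalizing a b t s with
  | _ n ih =>
  by_cases hpp : p.IsPath
  · exact hpath a b t s p ha hb hpp hp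
  obtain ⟨x, y, A, h, q, B, hq, rfl⟩ := exists_append_cons_append_of_not_isPath p hpp
  have hlen : n = A.length + (q.length + 1 + B.length) := by
    rw [← hn]; simp; omega
  obtain ⟨hp1, hp2, hp3⟩ := hp
  simp only [SimpleGraph.Walk.edges_append (p := A),
    SimpleGraph.Walk.edges_append (p := SimpleGraph.Walk.cons h q)] at hp1 hp2 hp3 ⊢
  have hC : AltList M (SimpleGraph.Walk.cons h q).edges :=
    (altList_append.1 (altList_append.1 hp1).2.1).1
  have hcyc := isCycle_cons_of_altList h q hq hC
  have hhead : (SimpleGraph.Walk.cons h q).edges.head? = some s(x, y) := by simp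
  obtain ⟨f, hf⟩ : ∃ f, (SimpleGraph.Walk.cons h q).edges.getLast? = some f :=
    ⟨_, List.getLast?_eq_some_getLast (by simp)⟩
  have hodd := hC.odd_length_iff hhead hf
  rw [SimpleGraph.Walk.length_edges] at hodd
  have hlast := hM.last_notMem_of_isCycle hcyc hf
  rw [gain_append, gain_append]
  by_cases hef : s(x, y) ∈ M ↔ f ∉ M
  · have hgain : gain w M (SimpleGraph.Walk.cons h q).edges ≤ 0 := by
      by_contra hpos
      refine hnoCycle x (.cons h q) ⟨⟨hcyc, ?_, hC, ?_⟩, ?_⟩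
      · rw [← Nat.not_odd_iff_even, hodd]; tauto
      · intro e' f' he' hf'
        rw [hhead] at he'
        rw [hf] at hf'
        cases he'; cases hf'
        exact hef
      · unfold gain at hpos; linarith
    have hAB : IsMatchedWalk M (A.append B) := by
      unfold IsMatchedWalk
      rw [SimpleGraph.Walk.edges_append]
      exact altList_splice hhead hf hef hp1 hp2 hp3
    have := ih (A.append B).length (by simp; omega) (A.append B) ha hb hAB rfl
    rw [SimpleGraph.Walk.edges_append, gain_append] at this
    linarith
  · have heM : s(x, y) ∉ M := by tauto
    have hfM : f ∉ M := by tauto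
    obtain ⟨hA, hB⟩ := altList_split hhead hf heM hfM hp1 hp2 hp3
    have hT := hblossom x (.cons h q) ⟨hcyc, hodd.2 (by tauto), hC, by
      intro e he
      rw [hhead] at he
      cases he
      exact heM⟩
    have h1 := ih A.length (by omega) A ha hT hA rfl
    have h2 := ih B.length (by omega) B hT hb hB rfl
    linarith

/-- if `G` has no M-augmenting cycle, no M-augmenting bi-cycle and no
M-augmenting flower with M-covered root, `u` is M-exposed, `v` is M-covered and
there is no M-augmenting flower rooted at `u`, then there is an M-augmenting path
from `u` to `v` iff there is an M-augmenting walk from `u` to `v` of length at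
most `3n`. -/
theorem augPath_iff_augWalk_covered
    {V : Type*} [Fintype V] [DecidableEq V] (G : SimpleGraph V)
    (w : Sym2 V → ℝ) (hw : ∀ e, 0 ≤ w e)
    (M : Finset (Sym2 V)) (hM : IsMatching G M)
    (hnoCycle : ∀ (a : V) (c : G.Walk a a), ¬ IsAugCycle w M c)
    (hnoBicycle : ∀ (a b : V) (c : G.Walk a a) (q : G.Walk a b) (d : G.Walk b b),
      ¬ IsAugBicycle w M c q d)
    (hnoCoveredFlower : ∀ (a r : V) (c : G.Walk a a) (q : G.Walk a r),
      ¬ MExposed M r → ¬ IsAugFlower w M c q)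
    (u v : V) (hu : MExposed M u) (hv : ¬ MExposed M v)
    (hnoFlowerAtu : ∀ (a : V) (c : G.Walk a a) (q : G.Walk a u),
      ¬ IsAugFlower w M c q) :
    (∃ q : G.Walk u v, IsAugPath w M q) ↔
    (∃ p : G.Walk u v, IsAugWalk w M p ∧ p.length ≤ 3 * Fintype.card V) := by
  constructor
  · rintro ⟨q, hq, hq'⟩
    exact ⟨q, hq', by have := hq.length_lt; omega⟩
  rintro ⟨p, ⟨hpa, ⟨-, hpl⟩, hpw⟩, -⟩
  replace hpl := hpl.resolve_left hv
  by_contra hno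
  cases p with
  | nil => exact hv hu
  | @cons _ x _ hux p =>
  have hnot : s(u, x) ∉ M := fun hm => hu _ hm (by simp)
  have hp : IsMatchedWalk M p := by
    cases p with
    | nil =>
      obtain ⟨e, he, hee⟩ := hpl
      have : s(u, v) = e := by simpa using hee
      exact absurd (this ▸ he) hnot
    | @cons _ y _ hxy q =>
      have h' := List.isChain_cons_cons.1 hpa
      exact ⟨h'.2, ⟨s(x, y), by tauto, by simp⟩, by simpa using hpl⟩
  have hpos : 0 < w s(u, x) + gain w M p.edges := by
    rw [← gain_cons_of_notMem w hnot]
    exact sub_pos.2 hpw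
  let T : V → ℝ → Prop := fun a t => (a = v ∧ t = 0) ∨ (a = x ∧ t = w s(u, x)) ∨
    ∃ c : G.Walk a a, IsBlossom M c ∧ t = gain w M c.edges / 2
  have hcons : ∀ (b : V) (q : G.Walk x b), q.IsPath → IsMatchedWalk M q →
      (SimpleGraph.Walk.cons hux q).IsPath ∧ AltList M (SimpleGraph.Walk.cons hux q).edges ∧
        (∃ e ∈ M, (SimpleGraph.Walk.cons hux q).edges.getLast? = some e) ∧
        gain w M (SimpleGraph.Walk.cons hux q).edges = w s(u, x) + gain w M q.edges := by
    intro b q hq hqm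
    refine ⟨hq.cons fun hmem => hqm.not_mExposed hmem hu, ?_, ?_, gain_cons_of_notMem w hnot _⟩
    · rw [SimpleGraph.Walk.edges_cons, ← List.singleton_append, altList_append]
      refine ⟨List.isChain_singleton _, hqm.1, ?_⟩
      obtain ⟨e, he, hee⟩ := hqm.2.1
      intro g hg k hk
      rw [hee] at hk
      simp at hg hk
      subst hg hk
      tauto
    · obtain ⟨e, he, hee⟩ := hqm.2.2
      exact ⟨e, he, by simp [List.getLast?_cons, hee]⟩
  have hvx : ∀ q : G.Walk x v, q.IsPath → IsMatchedWalk M q →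
      w s(u, x) + gain w M q.edges ≤ 0 := by
    intro q hq hqm
    obtain ⟨h1, h2, h3, h4⟩ := hcons v q hq hqm
    by_contra hlt
    refine hno ⟨.cons hux q, h1, h2, ⟨Or.inl hu, Or.inr h3⟩, ?_⟩
    rw [← h4] at hlt
    unfold gain at hlt
    linarith
  have hvc : ∀ (a : V) (c : G.Walk a a) (q : G.Walk a v), IsBlossom M c → q.IsPath →
      IsMatchedWalk M q → gain w M c.edges / 2 + gain w M q.edges ≤ 0 := by
    intro a c q hc hq hqm
    by_contra hlt
    refine hnoCoveredFlower a v c q hv ⟨⟨hc, hq, hqm.1, hqm.2.1, Or.inr hqm.2.2⟩, ?_⟩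
    unfold gain at hlt
    linarith
  have hxc : ∀ (a : V) (c : G.Walk a a) (q : G.Walk x a), IsBlossom M c → q.IsPath →
      IsMatchedWalk M q → w s(u, x) + gain w M q.edges + gain w M c.edges / 2 ≤ 0 := by
    intro a c q hc hq hqm
    obtain ⟨h1, h2, h3, h4⟩ := hcons a q hq hqm
    by_contra hlt
    refine hnoFlowerAtu a c (SimpleGraph.Walk.cons hux q).reverse
      ⟨⟨hc, h1.reverse, ?_, ?_, Or.inl hu⟩, ?_⟩
    · rw [SimpleGraph.Walk.edges_reverse]; exact altList_reverse h2
    · rw [SimpleGraph.Walk.edges_reverse, List.head?_reverse]; exact h3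
    · rw [← gain_reverse, ← SimpleGraph.Walk.edges_reverse] at h4
      rw [← h4] at hlt
      unfold gain at hlt
      linarith
  have hpath : ∀ (a b : V) (t s : ℝ) (q : G.Walk a b), T a t → T b s → q.IsPath →
      IsMatchedWalk M q → t + gain w M q.edges + s ≤ 0 := by
    intro a b t s q ha hb hq hqm
    have hrev := gain_reverse w M q.edges
    rw [← SimpleGraph.Walk.edges_reverse] at hrev
    rcases ha with ⟨rfl, rfl⟩ | ⟨rfl, rfl⟩ | ⟨c, hc, rfl⟩ <;>
      rcases hb with ⟨rfl, rfl⟩ | ⟨rfl, rfl⟩ | ⟨d, hd, rfl⟩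
    · exact absurd hq hqm.not_isPath
    · have := hvx q.reverse hq.reverse hqm.reverse
      linarith
    · have := hvc _ d q.reverse hd hq.reverse hqm.reverse
      linarith
    · have := hvx q hq hqm
      linarith
    · exact absurd hq hqm.not_isPath
    · exact hxc _ d q hd hq hqm
    · have := hvc _ c q hc hq hqm
      linarith
    · have := hxc _ c q.reverse hc hq.reverse hqm.reverse
      linarith
    · by_contra hlt
      refine hnoBicycle _ _ c q d
        ⟨⟨hc, hd, hq, hqm.odd_length, hqm.1, hqm.2.1, hqm.2.2⟩, ?_⟩
      unfold gain at hlt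
      linarith
  have := gain_le_zero_of_isMatchedWalk hM hnoCycle T
    (fun a c hc => Or.inr (Or.inr ⟨c, hc, rfl⟩)) hpath p
    (Or.inr (Or.inl ⟨rfl, rfl⟩)) (Or.inl ⟨rfl, rfl⟩) hp
  linarith

end Stabilizer
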